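/- Let A be a nontrivial antichain in P, let ω be a weight map, let r be a rational with 0 ≤ r < 1, and suppose y_r(A) ≠ ∅. Set r' := r · (min_{p ∈ y_r(A)} ω(p)) / (max_{p ∈ A} ω(p)). Then for every a ∈ A and every b ∈ y_r(A) it holds that ω({a} ∧_▵ {b})/ω(a) > r'; in other words, every element of A is a relatively r'-blocking element for the antichain y_r(A) in P. -/

import Mathlib

open scoped Classical

variable {α : Type*}

/-- The order ideal generated by a subset `S` of a poset. -/
def idl [PartialOrder α] (S : Set α) : Set α := {p | ∃ s ∈ S, p ≤ s}

/-- The order filter generated by a subset `S` of a poset. -/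
def filt [PartialOrder α] (S : Set α) : Set α := {p | ∃ s ∈ S, s ≤ p}

/-- The set of maximal elements of a subposet. -/
def maxOf [PartialOrder α] (S : Set α) : Set α := {x | x ∈ S ∧ ∀ y ∈ S, x ≤ y → x = y}

/-- The set of minimal elements of a subposet. -/
def minOf [PartialOrder α] (S : Set α) : Set α := {x | x ∈ S ∧ ∀ y ∈ S, y ≤ x → x = y}

/-- The meet `A ∧_▵ B := max (𝔍(A) ∩ 𝔍(B))` of antichains in `𝔄_▵(P)`. -/
def meetT [PartialOrder α] (A B : Set α) : Set α := maxOf (idl A ∩ idl B)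

/-- A weight map `ω` on antichains of `P`: `ω(∅) = -1`, `ω({⊥}) = 0`, and
`0 < ω(A') ≤ ω(A'')` whenever `{⊥} < A' ≤ A''` in `𝔄_▵(P)`. -/
structure WeightMap (α : Type*) [PartialOrder α] [OrderBot α] where
  w : Set α → ℤ
  w_empty : w (∅ : Set α) = -1
  w_bot : w ({⊥} : Set α) = 0
  w_pos_mono : ∀ A' A'' : Set α, IsAntichain (· ≤ ·) A' → IsAntichain (· ≤ ·) A'' →
    idl ({⊥} : Set α) ⊂ idl A' → idl A' ⊆ idl A'' → 0 < w A' ∧ w A' ≤ w A''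

/-- The subposet `I_r(P,A;ω)` of relatively `r`-blocking elements for `A` in `P`. -/
noncomputable def relBlock [PartialOrder α] [OrderBot α] (ω : WeightMap α) (r : ℚ)
    (A : Set α) : Set α :=
  if A = ∅ then Set.univ
  else if A = ({⊥} : Set α) then ∅
  else {b | b ≠ ⊥ ∧ ∀ a ∈ A \ {⊥}, r < (ω.w (meetT {b} {a}) : ℚ) / (ω.w {b} : ℚ)}

/-- The relative `r`-blocker map `y_r` on antichains: a nontrivial antichain is sent to
`min I_r(P,A;ω)`, and `∅ ↦ {⊥}`, `{⊥} ↦ ∅`. -/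
noncomputable def yr [PartialOrder α] [OrderBot α] (ω : WeightMap α) (r : ℚ)
    (A : Set α) : Set α :=
  if A = ∅ then ({⊥} : Set α)
  else if A = ({⊥} : Set α) then ∅
  else minOf (relBlock ω r A)

theorem meetT_comm [PartialOrder α] (A B : Set α) : meetT A B = meetT B A := by
  unfold meetT
  rw [Set.inter_comm]

theorem idl_bot_ssubset_idl_singleton [PartialOrder α] [OrderBot α] {p : α} (hp : p ≠ ⊥) :
    idl ({⊥} : Set α) ⊂ idl ({p} : Set α) := by
  refine ⟨?_, fun h => hp ?_⟩
  · rintro x ⟨s, rfl, hx⟩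
    exact ⟨p, rfl, hx.trans bot_le⟩
  · obtain ⟨s, rfl, hs⟩ := h ⟨p, rfl, le_rfl⟩
    exact le_bot_iff.mp hs

theorem WeightMap.w_singleton_pos [PartialOrder α] [OrderBot α] (ω : WeightMap α) {p : α}
    (hp : p ≠ ⊥) : 0 < ω.w {p} :=
  (ω.w_pos_mono {p} {p} IsAntichain.singleton IsAntichain.singleton
    (idl_bot_ssubset_idl_singleton hp) subset_rfl).1

theorem IsAntichain.ne_bot_of_mem [PartialOrder α] [OrderBot α] {A : Set α}
    (hA : IsAntichain (· ≤ ·) A) (hnt : A ≠ {⊥}) {a : α} (ha : a ∈ A) : a ≠ ⊥ := by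
  rintro rfl
  exact hnt (Set.Subset.antisymm (fun _ hx => (hA.eq ha hx bot_le).symm)
    (Set.singleton_subset_iff.mpr ha))

/-- If `A` is a nontrivial antichain with `y_r(A) ≠ ∅`, then every `a ∈ A` is a relatively
`r'`-blocking element for `y_r(A)`, where
`r' = r ⬝ (min_{p ∈ y_r(A)} ω(p)) / (max_{p ∈ A} ω(p))`. -/
theorem stmt_4 [Fintype α] [PartialOrder α] [BoundedOrder α] [Nontrivial α]
    (ω : WeightMap α) (r : ℚ) (hr0 : 0 ≤ r) (hr1 : r < 1)
    (A : Set α) (hA : IsAntichain (· ≤ ·) A) (hne : A ≠ ∅) (hnt : A ≠ ({⊥} : Set α))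
    (hy : yr ω r A ≠ ∅) :
    ∀ a ∈ A, ∀ b ∈ yr ω r A,
      r * ((sInf ((fun p => ω.w {p}) '' yr ω r A) : ℤ) : ℚ)
          / ((sSup ((fun p => ω.w {p}) '' A) : ℤ) : ℚ)
        < (ω.w (meetT {a} {b}) : ℚ) / (ω.w {a} : ℚ) := by
  intro a ha b hb
  have ha0 := hA.ne_bot_of_mem hnt ha
  have hmem : b ∈ relBlock ω r A := by
    rw [yr, if_neg hne, if_neg hnt] at hb
    exact hb.1
  rw [relBlock, if_neg hne, if_neg hnt] at hmem
  have hlt := hmem.2 a ⟨ha, ha0⟩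
  have hωa : (0 : ℚ) < ω.w {a} := by exact_mod_cast ω.w_singleton_pos ha0
  have hωb : (0 : ℚ) < ω.w {b} := by exact_mod_cast ω.w_singleton_pos hmem.1
  have hinf : ((sInf ((fun p => ω.w {p}) '' yr ω r A) : ℤ) : ℚ) ≤ ω.w {b} := by
    exact_mod_cast csInf_le (Set.toFinite _).bddBelow (Set.mem_image_of_mem _ hb)
  have hsup : (ω.w {a} : ℚ) ≤ ((sSup ((fun p => ω.w {p}) '' A) : ℤ) : ℚ) := by
    exact_mod_cast le_csSup (Set.toFinite _).bddAbove
      (Set.mem_image_of_mem (fun p => ω.w {p}) ha)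
  rw [lt_div_iff₀ hωb, meetT_comm] at hlt
  calc _ ≤ r * (ω.w {b} : ℚ) / ((sSup ((fun p => ω.w {p}) '' A) : ℤ) : ℚ) :=
        div_le_div_of_nonneg_right (mul_le_mul_of_nonneg_left hinf hr0) (hωa.le.trans hsup)
    _ ≤ r * (ω.w {b} : ℚ) / (ω.w {a} : ℚ) :=
        div_le_div_of_nonneg_left (mul_nonneg hr0 hωb.le) hωa hsup
    _ < _ := div_lt_div_of_pos_right hlt hωa
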